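/- Let n ≥ 1. The endomorphism P₀ of the space of antisymmetric 2n×2n real matrices satisfies: (i) P₀(J) = (n−1)·J; (ii) for every antisymmetric A with A J = J A and Tr(Jᵀ A) = 0, P₀(A) = −A; (iii) for every antisymmetric A with A J = −J A, P₀(A) = A. (These identify the eigenvalues n−1, −1, +1 of the reshaped B₄ frame-coefficient tensor of the reference Gaussian state |0⟩^{⊗n}.) -/

import Mathlib

open Matrix

/-- The `2n × 2n` symplectic identity `J`: block diagonal with `n` copies of the `2 × 2`
block `[[0,1],[-1,0]]`. -/
def symplJ (n : ℕ) : Matrix (Fin (2 * n)) (Fin (2 * n)) ℝ :=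
  Matrix.of fun i j =>
    if (i : ℕ) % 2 = 0 ∧ (j : ℕ) = (i : ℕ) + 1 then 1
    else if (j : ℕ) % 2 = 0 ∧ (i : ℕ) = (j : ℕ) + 1 then -1
    else 0

/-- The endomorphism `P₀(A) = (½·Tr(Jᵀ A))·J − J·A·Jᵀ` (of the space of antisymmetric
`2n × 2n` real matrices, here given by its defining formula on all matrices). -/
noncomputable def P0 (n : ℕ) (A : Matrix (Fin (2 * n)) (Fin (2 * n)) ℝ) :
    Matrix (Fin (2 * n)) (Fin (2 * n)) ℝ :=
  ((1 / 2 : ℝ) * ((symplJ n)ᵀ * A).trace) • symplJ n - symplJ n * A * (symplJ n)ᵀ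

theorem symplJ_transpose (n : ℕ) : (symplJ n)ᵀ = -symplJ n := by
  ext i j
  simp only [symplJ, transpose_apply, Matrix.neg_apply, of_apply]
  split_ifs <;> first | omega | norm_num

theorem symplJ_mul_transpose (n : ℕ) : symplJ n * (symplJ n)ᵀ = 1 := by
  ext i j
  obtain ⟨k, hk⟩ : ∃ k : Fin (2 * n),
      ((i : ℕ) % 2 = 0 ∧ (k : ℕ) = i + 1) ∨ ((k : ℕ) % 2 = 0 ∧ (i : ℕ) = k + 1) := by
    have hi := i.isLt
    rcases Nat.mod_two_eq_zero_or_one i with h | h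
    · exact ⟨⟨i + 1, by omega⟩, Or.inl ⟨h, rfl⟩⟩
    · refine ⟨⟨i - 1, by omega⟩, Or.inr ⟨?_, ?_⟩⟩ <;> dsimp only <;> omega
  rw [mul_apply, Finset.sum_eq_single k]
  · simp only [symplJ, transpose_apply, of_apply, one_apply, Fin.ext_iff]
    split_ifs <;> first | omega | norm_num
  · intro l _ hl
    have hl' : (l : ℕ) ≠ k := fun h => hl (Fin.ext h)
    have h : symplJ n i l = 0 := by
      simp only [symplJ, of_apply]
      split_ifs <;> first | omega | rfl
    rw [h, zero_mul]
  · simp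

theorem symplJ_transpose_mul (n : ℕ) : (symplJ n)ᵀ * symplJ n = 1 :=
  mul_eq_one_comm.mp (symplJ_mul_transpose n)

theorem trace_symplJ_transpose_mul_of_anticomm {n : ℕ}
    {A : Matrix (Fin (2 * n)) (Fin (2 * n)) ℝ} (hA : A * symplJ n = -(symplJ n * A)) :
    ((symplJ n)ᵀ * A).trace = 0 := by
  have h := congrArg trace hA
  rw [trace_mul_comm, trace_neg] at h
  rw [symplJ_transpose, neg_mul, trace_neg]
  linarith

/-- Let `n ≥ 1`.  The endomorphism `P₀` of the space of antisymmetric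
`2n × 2n` real matrices satisfies: (i) `P₀(J) = (n−1)·J`; (ii) for every antisymmetric `A`
with `A J = J A` and `Tr(Jᵀ A) = 0`, `P₀(A) = −A`; (iii) for every antisymmetric `A` with
`A J = −J A`, `P₀(A) = A`. -/
theorem P0_eigenvalue_structure (n : ℕ) (hn : 1 ≤ n) :
    P0 n (symplJ n) = ((n : ℝ) - 1) • symplJ n
    ∧ (∀ A : Matrix (Fin (2 * n)) (Fin (2 * n)) ℝ, Aᵀ = -A →
        A * symplJ n = symplJ n * A → ((symplJ n)ᵀ * A).trace = 0 → P0 n A = -A)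
    ∧ (∀ A : Matrix (Fin (2 * n)) (Fin (2 * n)) ℝ, Aᵀ = -A →
        A * symplJ n = -(symplJ n * A) → P0 n A = A) := by
  refine ⟨?_, fun A _ hA htr => ?_, fun A _ hA => ?_⟩
  · rw [P0, symplJ_transpose_mul, Matrix.mul_assoc, symplJ_mul_transpose, trace_one,
      Fintype.card_fin, Matrix.mul_one, sub_smul, one_smul]
    push_cast
    ring_nf
  · rw [P0, htr, ← hA, Matrix.mul_assoc, symplJ_mul_transpose, Matrix.mul_one, mul_zero,
      zero_smul, zero_sub]
  · rw [P0, trace_symplJ_transpose_mul_of_anticomm hA, ← neg_eq_iff_eq_neg.mpr hA, neg_mul,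
      Matrix.mul_assoc, symplJ_mul_transpose, Matrix.mul_one, mul_zero, zero_smul, zero_sub,
      neg_neg]
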